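/- Let m ≥ 4, let s be the m-dimensional score vector with s(k) = 1/2 for all k ∈ {2, …, m−1}, and let s' be an m-dimensional score vector with s'(k) = α for all k ∈ {2, …, m−1}, where 1/2 < α ≤ 1. Then there exists a preference profile ≿ on X = {x, y_1, …, y_{m−1}} such that x is a Condorcet loser at ≿, f^s(≿) = {x}, and x ∉ f^{s'}(≿). -/

import Mathlib

open Finset

/-- A preference profile over `m` alternatives with `n` voters: voter `i`'s linear
order `≿_i` is encoded by the bijection `P i` sending each alternative to its
0-indexed rank (rank `0` = first, rank `m-1` = last); thus `y ≿_i x` iff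
`P i y ≤ P i x`, and the 1-indexed rank is `r(x, ≿_i) = (P i x : ℕ) + 1`. -/
abbrev Profile (m n : ℕ) := Fin n → (Fin m ≃ Fin m)

/-- `s` is a score vector for `m` alternatives: entries in `[0,1]`, weakly
decreasing, first entry `1`, last entry `0` (index `k : Fin m` corresponds to
the 1-indexed rank `k + 1`). -/
def IsScoreVec {m : ℕ} (s : Fin m → ℝ) : Prop :=
  Antitone s ∧ (∀ k, 0 ≤ s k ∧ s k ≤ 1) ∧
    (∀ k : Fin m, (k : ℕ) = 0 → s k = 1) ∧
    (∀ k : Fin m, (k : ℕ) = m - 1 → s k = 0)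

/-- The Borda score vector: 1-indexed, `s^B(k) = (m - k)/(m - 1)`, i.e.
0-indexed, `k ↦ (m - 1 - k)/(m - 1)`. -/
noncomputable def bordaVec (m : ℕ) : Fin m → ℝ :=
  fun k => ((m : ℝ) - 1 - (k : ℕ)) / ((m : ℝ) - 1)

/-- Total score `∑_{i ∈ N} s(r(x, ≿_i))` of alternative `x` at profile `P`. -/
noncomputable def score {m n : ℕ} (s : Fin m → ℝ) (P : Profile m n) (x : Fin m) : ℝ :=
  ∑ i, s (P i x)

/-- The choice set `f^s(≿)` of the scoring rule with score vector `s`. -/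
def winners {m n : ℕ} (s : Fin m → ℝ) (P : Profile m n) : Set (Fin m) :=
  {x | ∀ y, score s P y ≤ score s P x}

/-- `x` is a Condorcet loser at `P`: for every `y ≠ x`,
`|{i : y ≿_i x}| > |{i : x ≿_i y}|`. -/
def CondorcetLoser {m n : ℕ} (P : Profile m n) (x : Fin m) : Prop :=
  ∀ y, y ≠ x →
    (univ.filter fun i => P i x ≤ P i y).card <
      (univ.filter fun i => P i y ≤ P i x).card

/-- Three distinct alternatives can be placed at any three distinct ranks. -/
lemma exists_perm_three {X : Type*} [DecidableEq X] {a b c u v w : X}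
    (hab : a ≠ b) (hac : a ≠ c) (hbc : b ≠ c) (huv : u ≠ v) (huw : u ≠ w) (hvw : v ≠ w) :
    ∃ e : X ≃ X, e a = u ∧ e b = v ∧ e c = w := by
  obtain ⟨f, hfa, hfb⟩ : ∃ f : X ≃ X, f a = u ∧ f b = v := by
    refine ⟨(Equiv.swap a u).trans (Equiv.swap (Equiv.swap a u b) v), ?_, by simp⟩
    have : u ≠ Equiv.swap a u b := fun h => hab <| (Equiv.swap a u).injective <| by simpa using h
    simp [Equiv.swap_apply_of_ne_of_ne this huv]
  have hu : u ≠ f c := fun h => hac <| f.injective <| hfa.trans h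
  have hv : v ≠ f c := fun h => hbc <| f.injective <| hfb.trans h
  refine ⟨f.trans (Equiv.swap (f c) w), ?_, ?_, by simp⟩
  · simp [hfa, Equiv.swap_apply_of_ne_of_ne hu huw]
  · simp [hfb, Equiv.swap_apply_of_ne_of_ne hv hvw]

/-- A profile in which `A` is cast `b + 1` times, `B` is cast `b` times, and each of
`C`, `D`, `E` is cast twice. -/
lemma exists_profile {m : ℕ} (b : ℕ) (A B C D E : Fin m ≃ Fin m) :
    ∃ n : ℕ, 0 < n ∧ ∃ P : Profile m n, ∀ g : (Fin m ≃ Fin m) → ℝ,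
      ∑ i, g (P i) = (b + 1) * g A + b * g B + 2 * (g C + g D + g E) := by
  let Q : (Fin (b + 1) ⊕ Fin b) ⊕ (Fin 2 × Fin 3) → (Fin m ≃ Fin m) :=
    Sum.elim (Sum.elim (fun _ => A) (fun _ => B)) (fun p => ![C, D, E] p.2)
  let ε := Fintype.equivFin ((Fin (b + 1) ⊕ Fin b) ⊕ (Fin 2 × Fin 3))
  refine ⟨_, Fintype.card_pos, fun i => Q (ε.symm i), fun g => ?_⟩
  rw [ε.symm.sum_comp (fun v => g (Q v))]
  simp [Q, Fintype.sum_sum_type, Fintype.sum_prod_type, Fin.sum_univ_three]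
  ring

/-- The score awarded by one ballot, for a score vector constant on the middle ranks. -/
lemma IsScoreVec.apply_perm {m : ℕ} {s : Fin m → ℝ} (hs : IsScoreVec s) {c : ℝ}
    (hmid : ∀ k : Fin m, 1 ≤ (k : ℕ) → (k : ℕ) ≤ m - 2 → s k = c)
    {e : Fin m ≃ Fin m} {a b : Fin m} (ha : (e a : ℕ) = 0) (hb : (e b : ℕ) = m - 1)
    (y : Fin m) : s (e y) = if y = a then 1 else if y = b then 0 else c := by
  split_ifs with h h'
  · exact hs.2.2.1 _ (h ▸ ha)
  · exact hs.2.2.2 _ (h' ▸ hb)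
  · have h1 : (e y : ℕ) ≠ e a := fun hh => h (e.injective (Fin.ext hh))
    have h2 : (e y : ℕ) ≠ e b := fun hh => h' (e.injective (Fin.ext hh))
    exact hmid _ (by omega) (by omega)

/-- An alternative ranked second to last is preferred only to the last one. -/
lemma perm_le_iff_of_second_last {m : ℕ} {e : Fin m ≃ Fin m} {x b y : Fin m} (hm : 2 ≤ m)
    (hx : (e x : ℕ) = m - 2) (hb : (e b : ℕ) = m - 1) (hy : y ≠ x) :
    (e x ≤ e y ↔ y = b) ∧ (e y ≤ e x ↔ y ≠ b) := by
  have h1 : (e y : ℕ) ≠ e x := fun hh => hy (e.injective (Fin.ext hh))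
  have h2 : y = b ↔ (e y : ℕ) = e b :=
    ⟨fun h => by rw [h], fun hh => e.injective (Fin.ext hh)⟩
  simp only [Fin.le_def, ne_eq, h2]
  omega

/-- Exceptional flat case: `s` has all middle entries `1/2`, `s'` has all middle
entries `α`. -/
theorem flat_case_alpha_gt_half
    (m : ℕ) (hm : 4 ≤ m) (α : ℝ) (hα1 : 1/2 < α) (hα2 : α ≤ 1)
    (s s' : Fin m → ℝ) (hs : IsScoreVec s) (hs' : IsScoreVec s')
    (hmid : ∀ k : Fin m, 1 ≤ (k : ℕ) → (k : ℕ) ≤ m - 2 → s k = 1/2)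
    (hmid' : ∀ k : Fin m, 1 ≤ (k : ℕ) → (k : ℕ) ≤ m - 2 → s' k = α) :
    ∃ n : ℕ, 0 < n ∧ ∃ P : Profile m n,
      CondorcetLoser P ⟨0, by omega⟩ ∧
      winners s P = {(⟨0, by omega⟩ : Fin m)} ∧
      (⟨0, by omega⟩ : Fin m) ∉ winners s' P := by
  obtain ⟨x, hx⟩ : ∃ x : Fin m, x = ⟨0, by omega⟩ := ⟨_, rfl⟩
  obtain ⟨y₁, hy₁⟩ : ∃ y : Fin m, y = ⟨1, by omega⟩ := ⟨_, rfl⟩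
  obtain ⟨y₂, hy₂⟩ : ∃ y : Fin m, y = ⟨2, by omega⟩ := ⟨_, rfl⟩
  obtain ⟨y₃, hy₃⟩ : ∃ y : Fin m, y = ⟨3, by omega⟩ := ⟨_, rfl⟩
  have hx1 : x ≠ y₁ := by simp [hx, hy₁]
  have hx2 : x ≠ y₂ := by simp [hx, hy₂]
  have hx3 : x ≠ y₃ := by simp [hx, hy₃]
  have h12 : y₁ ≠ y₂ := by simp [hy₁, hy₂]
  have h13 : y₁ ≠ y₃ := by simp [hy₁, hy₃]
  have h23 : y₂ ≠ y₃ := by simp [hy₂, hy₃]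
  rw [← hx]
  clear hx hy₁ hy₂ hy₃
  have ballot : ∀ a b c : Fin m, a ≠ b → a ≠ c → b ≠ c → ∃ e : Fin m ≃ Fin m,
      (e a : ℕ) = 0 ∧ (e b : ℕ) = m - 1 ∧ (e c : ℕ) = m - 2 := by
    intro a b c hab hac hbc
    obtain ⟨e, ha, hb, hc⟩ := exists_perm_three hab hac hbc
      (u := (⟨0, by omega⟩ : Fin m)) (v := ⟨m - 1, by omega⟩) (w := ⟨m - 2, by omega⟩)
      (by simp; omega) (by simp; omega) (by simp; omega)
    exact ⟨e, by simp [ha], by simp [hb], by simp [hc]⟩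
  obtain ⟨A, hA0, hA1, -⟩ := ballot x y₃ y₁ hx3 hx1 h13.symm
  obtain ⟨B, hB0, hB1, -⟩ := ballot y₃ x y₁ hx3.symm h13.symm hx1
  obtain ⟨C, hC0, hC1, hC2⟩ := ballot y₁ y₂ x h12 hx1.symm hx2.symm
  obtain ⟨D, hD0, hD1, hD2⟩ := ballot y₂ y₃ x h23 hx2.symm hx3.symm
  obtain ⟨E, hE0, hE1, hE2⟩ := ballot y₃ y₁ x h13.symm hx3.symm hx1.symm
  obtain ⟨b, hb⟩ := exists_nat_gt (2 + (1 - α) / (2 * α - 1))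
  have hb' : 1 - α < (b - 2) * (2 * α - 1) := by
    rw [← div_lt_iff₀ (by linarith)]
    linarith
  obtain ⟨n, hn, P, hP⟩ := exists_profile b A B C D E
  have hscore : ∀ (t : Fin m → ℝ) (y : Fin m), score t P y =
      (b + 1) * t (A y) + b * t (B y) + 2 * (t (C y) + t (D y) + t (E y)) :=
    fun t y => hP fun e => t (e y)
  have hlt : ∀ y, y ≠ x → score s P y < score s P x := by
    intro y hy
    simp only [hscore, hs.apply_perm hmid hA0 hA1, hs.apply_perm hmid hB0 hB1,
      hs.apply_perm hmid hC0 hC1, hs.apply_perm hmid hD0 hD1, hs.apply_perm hmid hE0 hE1]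
    by_cases e1 : y = y₁
    · subst e1
      simp [*, hx1.symm]
      linarith
    by_cases e2 : y = y₂
    · subst e2
      simp [*, h12.symm]
      linarith
    by_cases e3 : y = y₃
    · subst e3
      simp [*, h13.symm, h23.symm]
      linarith
    simp [*]
    linarith
  refine ⟨n, hn, P, fun y hy => ?_, ?_, fun h => ?_⟩
  · rw [← Nat.cast_lt (α := ℝ)]
    simp only [card_filter, Nat.cast_sum, Nat.cast_ite, Nat.cast_one, Nat.cast_zero]
    rw [hP fun e => if e x ≤ e y then (1 : ℝ) else 0, hP fun e => if e y ≤ e x then (1 : ℝ) else 0]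
    have hAy : ¬ A y ≤ A x := fun h => hy (A.injective (Fin.ext (by rw [Fin.le_def] at h; omega)))
    have hBy : ¬ B x ≤ B y := fun h => hy (B.injective (Fin.ext (by rw [Fin.le_def] at h; omega)))
    have hm2 : 2 ≤ m := by omega
    simp only [hAy, hBy, (not_le.1 hAy).le, (not_le.1 hBy).le,
      perm_le_iff_of_second_last hm2 hC2 hC1 hy, perm_le_iff_of_second_last hm2 hD2 hD1 hy,
      perm_le_iff_of_second_last hm2 hE2 hE1 hy]
    by_cases e1 : y = y₁
    · subst e1
      simp [*]
      linarith
    by_cases e2 : y = y₂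
    · subst e2
      simp [*]
      linarith
    by_cases e3 : y = y₃
    · subst e3
      simp [*]
      linarith
    simp [*]
    linarith
  · ext y
    refine ⟨fun h => ?_, ?_⟩
    · by_contra hy
      exact (hlt y hy).not_ge (h x)
    · rintro rfl z
      rcases eq_or_ne z y with rfl | hz
      exacts [le_rfl, (hlt z hz).le]
  · have := h y₁
    simp only [hscore, hs'.apply_perm hmid' hA0 hA1, hs'.apply_perm hmid' hB0 hB1,
      hs'.apply_perm hmid' hC0 hC1, hs'.apply_perm hmid' hD0 hD1,
      hs'.apply_perm hmid' hE0 hE1] at this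
    simp [hx1, hx2, hx3, h12, h13, hx1.symm] at this
    linarith
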